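/- arXiv:2402.02264 — 2 statements merged into one kernel-verified Lean document; each statement's English description precedes it below -/
import Mathlib

section
/- Let n ≥ 1 and let Z̄_n be the mean of n independent PN(μ_X,μ_Y;σ_X²,σ_Y²;ρ) random variables, and write μ'_k = E[Z̄_n^k] (with μ'_k = 0 by convention for k < 0 and μ'_0 = 1). Then for every integer k ≥ 0: μ'_{k+1} = (μ_Xμ_Y + s_nρ(4k+n))·μ'_k − s_n²k(n(2ρ r_X r_Y − r_X² − r_Y² + 3ρ² − 1) + (k−1)(6ρ²−2))·μ'_{k−1} − s_n³k(k−1)(n(ρ r_Y² − ρ² r_X r_Y − r_X r_Y + ρ r_X² + 3ρ(1−ρ²)) + 4(k−2)ρ(1−ρ²))·μ'_{k−2} − s_n⁴k(k−1)(k−2)(1−ρ²)²(n+k−3)·μ'_{k−3}. -/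
open MeasureTheory ProbabilityTheory

/-- The product-normal law `PN(μX, μY; σX², σY²; ρ)`: the law of `X * Y` where
`X = μX + σX * U`, `Y = μY + σY * (ρ * U + √(1 - ρ²) * V)` and `U, V` are independent
standard normal random variables. -/
noncomputable def PN (μX μY σX σY ρ : ℝ) : Measure ℝ :=
  Measure.map
    (fun p : ℝ × ℝ =>
      (μX + σX * p.1) * (μY + σY * (ρ * p.1 + Real.sqrt (1 - ρ ^ 2) * p.2)))
    ((gaussianReal 0 1).prod (gaussianReal 0 1))

/-- The law of the mean `Z̄ₙ = n⁻¹ ∑ᵢ Zᵢ` of `n` independent random variables with law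
`PN(μX, μY; σX², σY²; ρ)`. -/
noncomputable def PNbar (n : ℕ) (μX μY σX σY ρ : ℝ) : Measure ℝ :=
  Measure.map (fun ω : Fin n → ℝ => (∑ i, ω i) / (n : ℝ))
    (Measure.pi fun _ : Fin n => PN μX μY σX σY ρ)

lemma gaussianReal_exp_quadratic {a : ℝ} (ha : a < 1 / 2) (b c : ℝ) :
    Integrable (fun u : ℝ => Real.exp (a * u ^ 2 + b * u + c)) (gaussianReal 0 1) ∧
      ∫ u, Real.exp (a * u ^ 2 + b * u + c) ∂(gaussianReal 0 1) =
        (√(1 - 2 * a))⁻¹ * Real.exp (c + b ^ 2 / (2 * (1 - 2 * a))) := by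
  have hpos : 0 < 1 - 2 * a := by linarith
  have hre : ((a - 1 / 2 : ℝ) : ℂ).re < 0 := by rw [Complex.ofReal_re]; linarith
  have hcast : ∀ x : ℝ, Complex.exp (((a - 1 / 2 : ℝ) : ℂ) * x ^ 2 + (b : ℂ) * x + (c : ℂ)) =
      ((Real.exp ((a - 1 / 2) * x ^ 2 + b * x + c) : ℝ) : ℂ) := fun x => by push_cast; rfl
  have hint := integrable_cexp_quadratic' hre b c
  have hval := integral_cexp_quadratic hre b c
  simp only [hcast] at hint hval
  have hintR : Integrable (fun x : ℝ => Real.exp ((a - 1 / 2) * x ^ 2 + b * x + c)) := by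
    exact hint.re
  have hvalR : ∫ x : ℝ, Real.exp ((a - 1 / 2) * x ^ 2 + b * x + c) =
      √(Real.pi / (1 / 2 - a)) * Real.exp (c - b ^ 2 / (4 * (a - 1 / 2))) := by
    have h2 : (Real.pi / -((a - 1 / 2 : ℝ) : ℂ)) ^ (1 / 2 : ℂ) =
        ((√(Real.pi / (1 / 2 - a)) : ℝ) : ℂ) := by
      rw [Real.sqrt_eq_rpow, Complex.ofReal_cpow (div_nonneg Real.pi_pos.le (by linarith))]
      push_cast
      congr 2
      ring
    rw [integral_complex_ofReal, h2] at hval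
    exact_mod_cast hval
  have hpdf : ∀ x : ℝ, gaussianPDFReal 0 1 x * Real.exp (a * x ^ 2 + b * x + c) =
      (√(2 * Real.pi))⁻¹ * Real.exp ((a - 1 / 2) * x ^ 2 + b * x + c) := fun x => by
    simp only [gaussianPDFReal, NNReal.coe_one, mul_one, sub_zero]
    rw [mul_assoc, ← Real.exp_add]
    ring_nf
  constructor
  · rw [gaussianReal_of_var_ne_zero _ one_ne_zero,
      integrable_withDensity_iff_integrable_smul' (measurable_gaussianPDF 0 1)
        (ae_of_all _ fun _ => gaussianPDF_lt_top)]
    simp only [toReal_gaussianPDF, smul_eq_mul, hpdf]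
    exact hintR.const_mul _
  · rw [integral_gaussianReal_eq_integral_smul one_ne_zero]
    simp only [smul_eq_mul, hpdf]
    rw [integral_const_mul, hvalR, ← mul_assoc]
    congr 1
    · rw [← Real.sqrt_inv, ← Real.sqrt_inv, ← Real.sqrt_mul (by positivity)]
      congr 1
      have : (1 / 2 - a) ≠ 0 := by linarith
      have := Real.pi_ne_zero
      field_simp
    · congr 1
      have : a - 1 / 2 ≠ 0 := by linarith
      have := hpos.ne'
      grind

/-- The moment generating function of `PN(rX, rY; 1, 1; ρ)` on the set where
`0 < 1 - 2 * ρ * u - (1 - ρ ^ 2) * u ^ 2`. -/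
noncomputable def standardPNMgf (rX rY ρ u : ℝ) : ℝ :=
  (√(1 - 2 * ρ * u - (1 - ρ ^ 2) * u ^ 2))⁻¹ *
    Real.exp ((rX * rY * u + (rX ^ 2 + rY ^ 2 - 2 * ρ * (rX * rY)) / 2 * u ^ 2) /
      (1 - 2 * ρ * u - (1 - ρ ^ 2) * u ^ 2))

lemma measurable_productNormal (μX μY σX σY ρ : ℝ) : Measurable (fun p : ℝ × ℝ =>
    (μX + σX * p.1) * (μY + σY * (ρ * p.1 + √(1 - ρ ^ 2) * p.2))) := by
  fun_prop

instance (μX μY σX σY ρ : ℝ) : IsProbabilityMeasure (PN μX μY σX σY ρ) :=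
  Measure.isProbabilityMeasure_map (measurable_productNormal μX μY σX σY ρ).aemeasurable

lemma mgf_PN {μX μY σX σY ρ rX rY : ℝ} (hμX : μX = σX * rX) (hμY : μY = σY * rY)
    (hρ : ρ ^ 2 ≤ 1) {t : ℝ}
    (ht : 0 < 1 - 2 * ρ * (σX * σY * t) - (1 - ρ ^ 2) * (σX * σY * t) ^ 2) :
    mgf id (PN μX μY σX σY ρ) t = standardPNMgf rX rY ρ (σX * σY * t) := by
  set κ : ℝ := 1 - ρ ^ 2 with hκ
  have hsq : √κ ^ 2 = κ := Real.sq_sqrt (by linarith)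
  set D : ℝ := 1 - 2 * ρ * (σX * σY * t) - κ * (σX * σY * t) ^ 2 with hD
  have hinner : ∀ x : ℝ,
      Integrable (fun y => Real.exp (t * ((μX + σX * x) * (μY + σY * (ρ * x + √κ * y)))))
        (gaussianReal 0 1) ∧
      ∫ y, Real.exp (t * ((μX + σX * x) * (μY + σY * (ρ * x + √κ * y)))) ∂(gaussianReal 0 1) =
        Real.exp ((1 - D) / 2 * x ^ 2 +
          (t * (μX * σY * ρ + σX * μY) + t ^ 2 * μX * σX * σY ^ 2 * κ) * x +
          (t * μX * μY + t ^ 2 * μX ^ 2 * σY ^ 2 * κ / 2)) := fun x => by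
    have h := gaussianReal_exp_quadratic (a := 0) (by norm_num) (t * (μX + σX * x) * σY * √κ)
      (t * (μX + σX * x) * (μY + σY * (ρ * x)))
    have e : ∀ y, 0 * y ^ 2 + t * (μX + σX * x) * σY * √κ * y +
        t * (μX + σX * x) * (μY + σY * (ρ * x)) =
        t * ((μX + σX * x) * (μY + σY * (ρ * x + √κ * y))) := fun y => by ring
    simp only [e] at h
    refine ⟨h.1, h.2.trans ?_⟩
    simp only [mul_zero, sub_zero, Real.sqrt_one, inv_one, one_mul, mul_one, mul_pow, hsq, hD]
    congr 1
    ring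
  have houter := gaussianReal_exp_quadratic (a := (1 - D) / 2) (by linarith)
    (t * (μX * σY * ρ + σX * μY) + t ^ 2 * μX * σX * σY ^ 2 * κ)
    (t * μX * μY + t ^ 2 * μX ^ 2 * σY ^ 2 * κ / 2)
  have hint : Integrable (fun p : ℝ × ℝ =>
      Real.exp (t * ((μX + σX * p.1) * (μY + σY * (ρ * p.1 + √κ * p.2)))))
      ((gaussianReal 0 1).prod (gaussianReal 0 1)) := by
    refine (integrable_prod_iff (by fun_prop)).2 ⟨ae_of_all _ fun x => (hinner x).1, ?_⟩
    simp only [Real.norm_eq_abs, Real.abs_exp, (hinner _).2]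
    exact houter.1
  rw [PN, mgf_id_map (measurable_productNormal μX μY σX σY ρ).aemeasurable, mgf,
    integral_prod _ hint]
  simp only [(hinner _).2]
  rw [houter.2, standardPNMgf, ← hκ, ← hD]
  have e1 : 1 - 2 * ((1 - D) / 2) = D := by ring
  rw [e1]
  congr 2
  have := ht.ne'
  rw [eq_div_iff this, add_mul, div_mul_eq_mul_div, mul_comm 2 D, ← div_div,
    mul_div_cancel_right₀ _ this, hD, hκ, hμX, hμY]
  ring

lemma hasDerivAt_standardPNMgf (rX rY ρ : ℝ) {u : ℝ}
    (hu : 0 < 1 - 2 * ρ * u - (1 - ρ ^ 2) * u ^ 2) :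
    HasDerivAt (standardPNMgf rX rY ρ)
      (standardPNMgf rX rY ρ u *
        ((ρ + (1 - ρ ^ 2) * u) * (1 - 2 * ρ * u - (1 - ρ ^ 2) * u ^ 2) +
          (rX * rY + (rX ^ 2 + rY ^ 2 - 2 * ρ * (rX * rY)) * u +
            (rX * rY + ρ ^ 2 * (rX * rY) - ρ * rX ^ 2 - ρ * rY ^ 2) * u ^ 2)) /
        (1 - 2 * ρ * u - (1 - ρ ^ 2) * u ^ 2) ^ 2) u := by
  have hD : HasDerivAt (fun u => 1 - 2 * ρ * u - (1 - ρ ^ 2) * u ^ 2)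
      (-(2 * ρ) - (1 - ρ ^ 2) * (2 * u)) u := by
    have := (((hasDerivAt_id u).const_mul (2 * ρ)).const_sub 1).sub
      (((hasDerivAt_id u).pow 2).const_mul (1 - ρ ^ 2))
    exact this.congr_deriv (by simp)
  have hN : HasDerivAt (fun u => rX * rY * u +
      (rX ^ 2 + rY ^ 2 - 2 * ρ * (rX * rY)) / 2 * u ^ 2)
      (rX * rY + (rX ^ 2 + rY ^ 2 - 2 * ρ * (rX * rY)) / 2 * (2 * u)) u := by
    have := ((hasDerivAt_id u).const_mul (rX * rY)).add
      (((hasDerivAt_id u).pow 2).const_mul ((rX ^ 2 + rY ^ 2 - 2 * ρ * (rX * rY)) / 2))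
    exact this.congr_deriv (by simp)
  have hsqrt := (Real.sqrt_pos.2 hu).ne'
  have h := ((hD.sqrt hu.ne').inv hsqrt).mul (hN.div hD hu.ne').exp
  refine h.congr_deriv ?_
  have hs := Real.sq_sqrt hu.le
  simp only [standardPNMgf, Pi.inv_apply, Pi.div_apply]
  generalize Real.exp _ = E
  set S := √(1 - 2 * ρ * u - (1 - ρ ^ 2) * u ^ 2)
  rw [← hs]
  have h3 : 1 - 2 * ρ * u - (1 - ρ ^ 2) * u ^ 2 = S ^ 2 := hs.symm
  field_simp
  grind

lemma mgf_PNbar {n : ℕ} (μX μY σX σY ρ t : ℝ) :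
    mgf id (PNbar n μX μY σX σY ρ) t = mgf id (PN μX μY σX σY ρ) (t / n) ^ n := by
  have hindep : iIndepFun (fun (i : Fin n) (ω : Fin n → ℝ) => ω i)
      (Measure.pi fun _ : Fin n => PN μX μY σX σY ρ) :=
    iIndepFun_pi (X := fun _ => id) fun _ => aemeasurable_id
  have hcoord : ∀ i : Fin n, mgf (fun ω : Fin n → ℝ => ω i)
      (Measure.pi fun _ : Fin n => PN μX μY σX σY ρ) = mgf id (PN μX μY σX σY ρ) := fun i => by
    rw [← mgf_id_map (measurable_pi_apply i).aemeasurable]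
    congr 1
    exact (measurePreserving_eval (fun _ : Fin n => PN μX μY σX σY ρ) i).map_eq
  have hsum := hindep.mgf_sum (t := t / n) (fun i => by fun_prop) Finset.univ
  simp only [hcoord, Finset.prod_const, Finset.card_univ, Fintype.card_fin] at hsum
  rw [PNbar, mgf_id_map (by fun_prop), ← hsum]
  simp only [mgf, Finset.sum_apply]
  congr 1 with ω
  ring_nf

lemma iteratedDeriv_id_mul_zero {f : ℝ → ℝ} {k : ℕ} (hf : ContDiffAt ℝ k f 0) :
    iteratedDeriv k (fun t => t * f t) 0 = k * iteratedDeriv (k - 1) f 0 := by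
  rw [iteratedDeriv_fun_mul contDiffAt_fun_id hf]
  rcases k with _ | k
  · simp
  · rw [Finset.sum_eq_single 1]
    · simp
    · intro i _ hi
      rcases i with _ | _ | i
      · simp
      · exact absurd rfl hi
      · simp [iteratedDeriv_fun_id]
    · simp

lemma iteratedDeriv_pow_mul_zero {f : ℝ → ℝ} (j : ℕ) {k : ℕ} (hf : ContDiffAt ℝ ⊤ f 0) :
    iteratedDeriv k (fun t => t ^ j * f t) 0 =
      k.descFactorial j * iteratedDeriv (k - j) f 0 := by
  induction j generalizing k with
  | zero => simp
  | succ j ih =>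
    have e : (fun t : ℝ => t ^ (j + 1) * f t) = fun t => t * (t ^ j * f t) := by ext t; ring
    rw [e, iteratedDeriv_id_mul_zero (f := fun t => t ^ j * f t), ih, ← mul_assoc]
    · rcases k with _ | k
      · simp
      · rw [Nat.succ_descFactorial_succ, Nat.add_sub_add_right]
        push_cast
        simp
    · exact (by fun_prop : ContDiffAt ℝ ⊤ (fun t : ℝ => t ^ j * f t) 0).of_le le_top


lemma mgf_PNbar_eq_standardPNMgf_pow {μX μY σX σY ρ rX rY s : ℝ} {n : ℕ}
    (hμX : μX = σX * rX) (hμY : μY = σY * rY) (hρ : ρ ^ 2 ≤ 1) (hs : s = σX * σY / n) {t : ℝ}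
    (ht : 0 < 1 - 2 * ρ * (s * t) - (1 - ρ ^ 2) * (s * t) ^ 2) :
    mgf id (PNbar n μX μY σX σY ρ) t = standardPNMgf rX rY ρ (s * t) ^ n := by
  have e : σX * σY * (t / n) = s * t := by rw [hs]; ring
  rw [mgf_PNbar, mgf_PN hμX hμY hρ (by rwa [e]), e]

lemma mem_interior_integrableExpSet_of_eventually_mgf_pos {Ω : Type*} [MeasurableSpace Ω]
    {μ : Measure Ω} [NeZero μ] {X : Ω → ℝ} {v : ℝ} (h : ∀ᶠ t in nhds v, 0 < mgf X μ t) :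
    v ∈ interior (integrableExpSet X μ) :=
  mem_interior_iff_mem_nhds.2 (h.mono fun _ ht => mgf_pos_iff.1 ht)

instance (n : ℕ) (μX μY σX σY ρ : ℝ) : IsProbabilityMeasure (PNbar n μX μY σX σY ρ) :=
  Measure.isProbabilityMeasure_map (by fun_prop)

lemma cast_descFactorial_succ (k i : ℕ) :
    (k.descFactorial (i + 1) : ℝ) = (k - i) * k.descFactorial i := by
  rw [Nat.descFactorial_succ, Nat.cast_mul]
  rcases le_or_gt i k with h | h
  · rw [Nat.cast_sub h]
  · simp [Nat.descFactorial_of_lt h]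

lemma iteratedDeriv_succ_of_ode {f : ℝ → ℝ} (hf : ContDiffAt ℝ ⊤ f 0)
    {a₁ a₂ a₃ a₄ p₀ p₁ p₂ p₃ : ℝ}
    (hode : ∀ᶠ t in nhds 0, deriv f t = t ^ 1 * (a₁ * deriv f t) + t ^ 2 * (a₂ * deriv f t) +
      t ^ 3 * (a₃ * deriv f t) + t ^ 4 * (a₄ * deriv f t) +
      t ^ 0 * (p₀ * f t) + t ^ 1 * (p₁ * f t) + t ^ 2 * (p₂ * f t) + t ^ 3 * (p₃ * f t))
    (k : ℕ) :
    iteratedDeriv (k + 1) f 0 =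
      (p₀ + k * a₁) * iteratedDeriv k f 0 +
      k * (p₁ + (k - 1) * a₂) * iteratedDeriv (k - 1) f 0 +
      k * (k - 1) * (p₂ + (k - 2) * a₃) * iteratedDeriv (k - 2) f 0 +
      k * (k - 1) * (k - 2) * (p₃ + (k - 3) * a₄) * iteratedDeriv (k - 3) f 0 := by
  have hf' : ContDiffAt ℝ ⊤ (deriv f) 0 := hf.derivWithin le_top
  have hterm : ∀ (g : ℝ → ℝ), ContDiffAt ℝ ⊤ g 0 → ∀ (c : ℝ) (j : ℕ),
      iteratedDeriv k (fun t => t ^ j * (c * g t)) 0 =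
        k.descFactorial j * (c * iteratedDeriv (k - j) g 0) := fun g hg c j => by
    rw [iteratedDeriv_pow_mul_zero j (by fun_prop), iteratedDeriv_const_mul_field]
  have hderiv : ∀ (c : ℝ) (j : ℕ), iteratedDeriv k (fun t => t ^ (j + 1) * (c * deriv f t)) 0 =
      k.descFactorial (j + 1) * (c * iteratedDeriv (k - j) f 0) := fun c j => by
    rw [hterm _ hf', ← iteratedDeriv_succ']
    rcases le_or_gt (j + 1) k with h | h
    · rw [show k - (j + 1) + 1 = k - j by omega]
    · rw [Nat.descFactorial_of_lt h]
      simp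
  have hsmooth : ∀ (g : ℝ → ℝ), ContDiffAt ℝ ⊤ g 0 → ∀ (c : ℝ) (j : ℕ),
      ContDiffAt ℝ k (fun t => t ^ j * (c * g t)) 0 := fun g hg c j =>
    (by fun_prop : ContDiffAt ℝ ⊤ (fun t => t ^ j * (c * g t)) 0).of_le le_top
  have hsf := hsmooth f hf
  have hsf' := hsmooth _ hf'
  have h := Filter.EventuallyEq.iteratedDeriv_eq k hode
  rw [← iteratedDeriv_succ'] at h
  rw [h]
  simp (discharger := fun_prop (disch := assumption)) only [iteratedDeriv_fun_add, hterm f hf,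
    hderiv _ 0, hderiv _ 1, hderiv _ 2, hderiv _ 3,
    cast_descFactorial_succ, Nat.descFactorial_zero, tsub_zero]
  push_cast
  ring

/-- Recursion for the raw moments `μ'ₖ = E[Z̄ₙᵏ]` of the mean `Z̄ₙ` of `n` independent
`PN(μX, μY; σX², σY²; ρ)` random variables (with the convention `μ'ₖ = 0` for `k < 0`). -/
theorem raw_moment_recursion_PNbar
    (μX μY σX σY ρ : ℝ) (hσX : 0 < σX) (hσY : 0 < σY)
    (hρ₁ : -1 < ρ) (hρ₂ : ρ < 1) (n : ℕ) (hn : 1 ≤ n)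
    (s rX rY : ℝ) (hs : s = σX * σY / n) (hrX : rX = μX / σX) (hrY : rY = μY / σY)
    (M : ℤ → ℝ)
    (hMneg : ∀ k : ℤ, k < 0 → M k = 0)
    (hMnat : ∀ k : ℕ, M k = ∫ x, x ^ k ∂(PNbar n μX μY σX σY ρ)) :
    ∀ k : ℕ,
      M (k + 1)
        = (μX * μY + s * ρ * (4 * k + n)) * M k
          - s ^ 2 * k * (n * (2 * ρ * rX * rY - rX ^ 2 - rY ^ 2 + 3 * ρ ^ 2 - 1)
              + (k - 1) * (6 * ρ ^ 2 - 2)) * M (k - 1)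
          - s ^ 3 * k * (k - 1)
            * (n * (ρ * rY ^ 2 - ρ ^ 2 * rX * rY - rX * rY + ρ * rX ^ 2 + 3 * ρ * (1 - ρ ^ 2))
                + 4 * (k - 2) * ρ * (1 - ρ ^ 2)) * M (k - 2)
          - s ^ 4 * k * (k - 1) * (k - 2) * (1 - ρ ^ 2) ^ 2 * (n + k - 3) * M (k - 3) := by
  have hμX : μX = σX * rX := by rw [hrX]; field_simp
  have hμY : μY = σY * rY := by rw [hrY]; field_simp
  have hρ : ρ ^ 2 ≤ 1 := by nlinarith
  have hnpos : (0 : ℝ) < n := by exact_mod_cast hn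
  set f := mgf id (PNbar n μX μY σX σY ρ) with hfdef
  have hev : ∀ᶠ t in nhds (0 : ℝ), 0 < 1 - 2 * ρ * (s * t) - (1 - ρ ^ 2) * (s * t) ^ 2 := by
    have hc : Continuous fun t : ℝ => 1 - 2 * ρ * (s * t) - (1 - ρ ^ 2) * (s * t) ^ 2 := by
      fun_prop
    exact hc.continuousAt.eventually (lt_mem_nhds (by simp))
  have hfeq : ∀ t : ℝ, 0 < 1 - 2 * ρ * (s * t) - (1 - ρ ^ 2) * (s * t) ^ 2 →
      f t = standardPNMgf rX rY ρ (s * t) ^ n := fun t ht =>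
    mgf_PNbar_eq_standardPNMgf_pow hμX hμY hρ hs ht
  have hint : (0 : ℝ) ∈ interior (integrableExpSet id (PNbar n μX μY σX σY ρ)) := by
    refine mem_interior_integrableExpSet_of_eventually_mgf_pos (hev.mono fun t ht => ?_)
    have := Real.sqrt_pos.2 ht
    rw [← hfdef, hfeq t ht, standardPNMgf]
    positivity
  have hM : ∀ k : ℕ, M k = iteratedDeriv k f 0 := fun k => by
    rw [hMnat, hfdef, iteratedDeriv_mgf_zero hint]
    rfl
  have hode : ∀ᶠ t in nhds 0, deriv f t = t ^ 1 * (4 * ρ * s * deriv f t) +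
      t ^ 2 * (-(6 * ρ ^ 2 - 2) * s ^ 2 * deriv f t) +
      t ^ 3 * (-(4 * ρ * (1 - ρ ^ 2)) * s ^ 3 * deriv f t) +
      t ^ 4 * (-(1 - ρ ^ 2) ^ 2 * s ^ 4 * deriv f t) +
      t ^ 0 * (n * s * (ρ + rX * rY) * f t) +
      t ^ 1 * (n * s ^ 2 * (1 - 3 * ρ ^ 2 + rX ^ 2 + rY ^ 2 - 2 * ρ * (rX * rY)) * f t) +
      t ^ 2 * (n * s ^ 3 * (-3 * ρ * (1 - ρ ^ 2) +
        (rX * rY + ρ ^ 2 * (rX * rY) - ρ * rX ^ 2 - ρ * rY ^ 2)) * f t) +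
      t ^ 3 * (-n * s ^ 4 * (1 - ρ ^ 2) ^ 2 * f t) := by
    filter_upwards [hev.eventually_nhds] with t ht
    have hD := ht.self_of_nhds
    have hd : HasDerivAt (fun t => standardPNMgf rX rY ρ (s * t) ^ n) _ t :=
      ((hasDerivAt_standardPNMgf rX rY ρ hD).comp t ((hasDerivAt_id t).const_mul s)).pow n
    have hd' := (hd.congr_of_eventuallyEq (ht.mono hfeq)).deriv
    rw [hfeq t hD]
    obtain ⟨m, rfl⟩ : ∃ m, n = m + 1 := ⟨n - 1, by omega⟩
    simp only [Nat.add_sub_cancel, Function.comp_apply, mul_one] at hd'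
    rw [pow_succ _ m]
    have hD2 := (pow_pos hD 2).ne'
    rw [← mul_div_right_comm, ← mul_div_assoc, eq_div_iff hD2] at hd'
    linear_combination hd'
  intro k
  have h := iteratedDeriv_succ_of_ode (analyticAt_mgf hint).contDiffAt hode k
  have hMsub : ∀ j : ℕ, (k.descFactorial j : ℝ) * M (k - j) =
      k.descFactorial j * iteratedDeriv (k - j) f 0 := fun j => by
    rcases le_or_gt j k with hj | hj
    · rw [← hM, Nat.cast_sub hj]
    · simp [Nat.descFactorial_of_lt hj]
  have h0 := hM k
  have h1 := hMsub 1
  have h2 := hMsub 2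
  have h3 := hMsub 3
  have hk := hM (k + 1)
  simp only [cast_descFactorial_succ, Nat.descFactorial_zero, Nat.cast_zero, Nat.cast_one,
    Nat.cast_ofNat, Nat.cast_add] at h1 h2 h3 hk
  have hμ : n * s * (rX * rY) = μX * μY := by
    rw [hs, hμX, hμY]
    field_simp
  rw [hk, h, ← h0, ← hμ]
  linear_combination
    -(n * s ^ 2 * (1 - 3 * ρ ^ 2 + rX ^ 2 + rY ^ 2 - 2 * ρ * (rX * rY)) +
        (k - 1) * (-(6 * ρ ^ 2 - 2) * s ^ 2)) * h1 -
      (n * s ^ 3 * (-3 * ρ * (1 - ρ ^ 2) +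
          (rX * rY + ρ ^ 2 * (rX * rY) - ρ * rX ^ 2 - ρ * rY ^ 2)) +
        (k - 2) * (-(4 * ρ * (1 - ρ ^ 2)) * s ^ 3)) * h2 -
      (-n * s ^ 4 * (1 - ρ ^ 2) ^ 2 + (k - 3) * (-(1 - ρ ^ 2) ^ 2 * s ^ 4)) * h3
end

section
/- Let n ≥ 1 and let Z̄_n be the mean of n independent PN(μ_X,μ_Y;σ_X²,σ_Y²;ρ) random variables. Then the first four raw moments of Z̄_n are: E[Z̄_n] = μ_Xμ_Y + ρσ_Xσ_Y; E[Z̄_n²] = (σ_X²σ_Y²/n)·(n r_X²r_Y² + r_X² + r_Y² + 2ρ(n+1)r_Xr_Y + ρ²(n+1) + 1); E[Z̄_n³] = (σ_X³σ_Y³/n²)·(n² r_X³r_Y³ + 3n r_Xr_Y(r_X²+r_Y²) + 3ρn(n+2)r_X²r_Y² + 3ρ(n+2)(r_X²+r_Y²) + 3(n+2)(ρ²(n+1)+1)r_Xr_Y + ρ(n+2)(ρ²(n+1)+3)); E[Z̄_n⁴] = (σ_X⁴σ_Y⁴/n³)·(n³ r_X⁴r_Y⁴ + 4ρn²(n+3)r_X³r_Y³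 + 6n² r_X²r_Y²(r_X²+r_Y²) + 3n(r_X⁴+r_Y⁴) + 12ρn(n+3)r_Xr_Y(r_X²+r_Y²) + 6n(ρ²(n+2)(n+3)+(n+5))r_X²r_Y² + 6(n+2)(ρ²(n+3)+1)(r_X²+r_Y²) + 4ρ(n+2)(n+3)(ρ²(n+1)+3)r_Xr_Y + ρ⁴(n+1)(n+2)(n+3) + 6ρ²(n+2)(n+3) + 3(n+2)). -/
open MeasureTheory ProbabilityTheory

lemma integrable_pow_gaussianReal (k : ℕ) :
    Integrable (fun x : ℝ => x ^ k) (gaussianReal 0 1) := by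
  have h := (memLp_id_gaussianReal (μ := 0) (v := 1) (k : NNReal)).integrable_norm_pow'
  exact h.mono' (by fun_prop) (.of_forall fun x => by simp)

lemma hasDerivAt_gaussianPDFReal_standard (x : ℝ) :
    HasDerivAt (gaussianPDFReal 0 1) (-x * gaussianPDFReal 0 1 x) x := by
  have h : HasDerivAt (fun y : ℝ => -(y - 0) ^ 2 / (2 * ((1 : NNReal) : ℝ))) (-x) x := by
    refine (((((hasDerivAt_id x).sub_const 0).pow 2).neg).div_const _).congr_deriv ?_
    simp; ring
  rw [gaussianPDFReal_def]
  refine (h.exp.const_mul _).congr_deriv ?_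
  ring

lemma integrable_pow_mul_gaussianPDFReal (k : ℕ) :
    Integrable (fun x : ℝ => x ^ k * gaussianPDFReal 0 1 x) := by
  have h := integrable_pow_gaussianReal k
  rw [gaussianReal_of_var_ne_zero _ one_ne_zero,
    integrable_withDensity_iff (measurable_gaussianPDF 0 1)
      (.of_forall fun x => gaussianPDF_lt_top)] at h
  simpa only [toReal_gaussianPDF] using h

/-- Stein's recursion for the moments of the standard normal law. -/
lemma integral_pow_add_two_gaussianReal (k : ℕ) :
    ∫ x, x ^ (k + 2) ∂(gaussianReal 0 1) = (k + 1) * ∫ x, x ^ k ∂(gaussianReal 0 1) := by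
  have hi (j : ℕ) := integrable_pow_mul_gaussianPDFReal j
  have key := integral_eq_zero_of_hasDerivAt_of_integrable
    (f := fun x : ℝ => x ^ (k + 1) * gaussianPDFReal 0 1 x)
    (f' := fun x : ℝ => (k + 1) * (x ^ k * gaussianPDFReal 0 1 x)
      - x ^ (k + 2) * gaussianPDFReal 0 1 x)
    (fun x => ((hasDerivAt_pow (k + 1) x).mul
      (hasDerivAt_gaussianPDFReal_standard x)).congr_deriv (by simp; ring))
    (((hi k).const_mul _).sub (hi (k + 2))) (hi (k + 1))
  rw [integral_sub ((hi k).const_mul _) (hi (k + 2)), integral_const_mul] at key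
  simp only [integral_gaussianReal_eq_integral_smul one_ne_zero, smul_eq_mul]
  simp only [mul_comm (gaussianPDFReal 0 1 _)]
  linarith

lemma integral_pow_zero_gaussianReal : ∫ x : ℝ, x ^ 0 ∂(gaussianReal 0 1) = 1 := by simp

lemma integral_pow_one_gaussianReal : ∫ x, x ^ 1 ∂(gaussianReal 0 1) = 0 := by
  simp only [pow_one, integral_id_gaussianReal]

lemma integral_pow_two_gaussianReal : ∫ x, x ^ 2 ∂(gaussianReal 0 1) = 1 := by
  rw [integral_pow_add_two_gaussianReal 0, integral_pow_zero_gaussianReal]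
  norm_num

lemma integral_pow_three_gaussianReal : ∫ x, x ^ 3 ∂(gaussianReal 0 1) = 0 := by
  rw [integral_pow_add_two_gaussianReal 1, integral_pow_one_gaussianReal]
  norm_num

lemma integral_pow_four_gaussianReal : ∫ x, x ^ 4 ∂(gaussianReal 0 1) = 3 := by
  rw [integral_pow_add_two_gaussianReal 2, integral_pow_two_gaussianReal]
  norm_num

lemma integral_pow_five_gaussianReal : ∫ x, x ^ 5 ∂(gaussianReal 0 1) = 0 := by
  rw [integral_pow_add_two_gaussianReal 3, integral_pow_three_gaussianReal]
  norm_num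

lemma integral_pow_six_gaussianReal : ∫ x, x ^ 6 ∂(gaussianReal 0 1) = 15 := by
  rw [integral_pow_add_two_gaussianReal 4, integral_pow_four_gaussianReal]
  norm_num

lemma integral_pow_seven_gaussianReal : ∫ x, x ^ 7 ∂(gaussianReal 0 1) = 0 := by
  rw [integral_pow_add_two_gaussianReal 5, integral_pow_five_gaussianReal]
  norm_num

lemma integral_pow_eight_gaussianReal : ∫ x, x ^ 8 ∂(gaussianReal 0 1) = 105 := by
  rw [integral_pow_add_two_gaussianReal 6, integral_pow_six_gaussianReal]
  norm_num

lemma affine_pow_mul_affine_pow_eq_sum (a s d e x : ℝ) (i j : ℕ) :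
    (a + s * x) ^ i * (d + e * x) ^ j
      = ∑ p ∈ Finset.range (i + 1), ∑ q ∈ Finset.range (j + 1),
          (s ^ p * a ^ (i - p) * i.choose p) * (e ^ q * d ^ (j - q) * j.choose q)
            * x ^ (p + q) := by
  rw [add_comm a, add_comm d, add_pow, add_pow, Finset.sum_mul_sum]
  refine Finset.sum_congr rfl fun p _ => Finset.sum_congr rfl fun q _ => ?_
  ring

lemma integrable_affine_pow_mul_affine_pow_gaussianReal (a s d e : ℝ) (i j : ℕ) :
    Integrable (fun x : ℝ => (a + s * x) ^ i * (d + e * x) ^ j) (gaussianReal 0 1) := by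
  simp only [affine_pow_mul_affine_pow_eq_sum]
  exact integrable_finsetSum _ fun p _ => integrable_finsetSum _ fun q _ =>
    (integrable_pow_gaussianReal (p + q)).const_mul _

lemma integral_affine_pow_mul_affine_pow_gaussianReal (a s d e : ℝ) (i j : ℕ) :
    ∫ x, (a + s * x) ^ i * (d + e * x) ^ j ∂(gaussianReal 0 1)
      = ∑ p ∈ Finset.range (i + 1), ∑ q ∈ Finset.range (j + 1),
          (s ^ p * a ^ (i - p) * i.choose p) * (e ^ q * d ^ (j - q) * j.choose q)
            * ∫ x, x ^ (p + q) ∂(gaussianReal 0 1) := by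
  simp only [affine_pow_mul_affine_pow_eq_sum]
  rw [integral_finsetSum _ fun p _ => integrable_finsetSum _ fun q _ =>
    (integrable_pow_gaussianReal (p + q)).const_mul _]
  refine Finset.sum_congr rfl fun p _ => ?_
  rw [integral_finsetSum _ fun q _ => (integrable_pow_gaussianReal (p + q)).const_mul _]
  simp only [integral_const_mul]

section Prod

variable {α β : Type*} [MeasurableSpace α] [MeasurableSpace β] {μ : Measure α} {ν : Measure β}

lemma mul_add_pow_eq_sum (h f g : ℝ) (k : ℕ) :
    h * (f + g) ^ k = ∑ j ∈ Finset.range (k + 1), (h * f ^ j) * (g ^ (k - j) * k.choose j) := by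
  rw [add_pow, Finset.mul_sum]
  exact Finset.sum_congr rfl fun j _ => by ring

lemma integrable_mul_add_pow_prod {h f : α → ℝ} {g : β → ℝ}
    (hf : ∀ j, Integrable (fun x => h x * f x ^ j) μ) (hg : ∀ j, Integrable (fun y => g y ^ j) ν)
    (k : ℕ) : Integrable (fun p : α × β => h p.1 * (f p.1 + g p.2) ^ k) (μ.prod ν) := by
  simp only [mul_add_pow_eq_sum]
  exact integrable_finsetSum _ fun j _ => (hf j).mul_prod ((hg (k - j)).mul_const _)

lemma integral_mul_add_pow_prod [SFinite μ] [SFinite ν] {h f : α → ℝ} {g : β → ℝ}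
    (hf : ∀ j, Integrable (fun x => h x * f x ^ j) μ) (hg : ∀ j, Integrable (fun y => g y ^ j) ν)
    (k : ℕ) :
    ∫ p, h p.1 * (f p.1 + g p.2) ^ k ∂(μ.prod ν)
      = ∑ j ∈ Finset.range (k + 1),
          (∫ x, h x * f x ^ j ∂μ) * ((∫ y, g y ^ (k - j) ∂ν) * k.choose j) := by
  simp only [mul_add_pow_eq_sum]
  rw [integral_finsetSum _ fun j _ => (hf j).mul_prod ((hg (k - j)).mul_const _)]
  refine Finset.sum_congr rfl fun j _ => ?_
  rw [integral_prod_mul (fun x => h x * f x ^ j) (fun y => g y ^ (k - j) * (k.choose j : ℝ)),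
    integral_mul_const]

end Prod

section Pi

variable {ν : Measure ℝ} [IsProbabilityMeasure ν]

lemma measurePreserving_piFinSuccAbove_zero_symm (n : ℕ) :
    MeasurePreserving (MeasurableEquiv.piFinSuccAbove (fun _ : Fin (n + 1) => ℝ) 0).symm
      (ν.prod (Measure.pi fun _ : Fin n => ν)) (Measure.pi fun _ : Fin (n + 1) => ν) :=
  (measurePreserving_piFinSuccAbove (fun _ : Fin (n + 1) => ν) 0).symm

lemma sum_piFinSuccAbove_zero_symm (n : ℕ) (p : ℝ × (Fin n → ℝ)) :
    ∑ i, (MeasurableEquiv.piFinSuccAbove (fun _ : Fin (n + 1) => ℝ) 0).symm p i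
      = p.1 + ∑ i, p.2 i := by
  simp [Fin.sum_univ_succ, MeasurableEquiv.piFinSuccAbove]

lemma integrable_sum_pow_pi (hν : ∀ k : ℕ, Integrable (fun x => x ^ k) ν) (n k : ℕ) :
    Integrable (fun ω : Fin n → ℝ => (∑ i, ω i) ^ k) (Measure.pi fun _ => ν) := by
  induction n generalizing k with
  | zero => simp
  | succ n ih =>
    rw [← (measurePreserving_piFinSuccAbove_zero_symm n).integrable_comp_emb
      (MeasurableEquiv.measurableEmbedding _)]
    simpa [Function.comp_def, sum_piFinSuccAbove_zero_symm] using
      integrable_mul_add_pow_prod (h := fun _ => 1) (f := fun x => x)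
        (by simpa using hν) ih k

lemma integral_sum_pow_pi_succ (hν : ∀ k : ℕ, Integrable (fun x => x ^ k) ν) (n k : ℕ) :
    ∫ ω : Fin (n + 1) → ℝ, (∑ i, ω i) ^ k ∂(Measure.pi fun _ => ν)
      = ∑ j ∈ Finset.range (k + 1), (∫ x, x ^ j ∂ν)
          * ((∫ ω : Fin n → ℝ, (∑ i, ω i) ^ (k - j) ∂(Measure.pi fun _ => ν)) * k.choose j) := by
  rw [← (measurePreserving_piFinSuccAbove_zero_symm n).integral_comp']
  simp only [sum_piFinSuccAbove_zero_symm]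
  simpa using
      integral_mul_add_pow_prod (h := fun _ => 1) (f := fun x => x)
        (by simpa using hν) (integrable_sum_pow_pi hν n) k

lemma integral_sum_pow_one_pi (hν : ∀ k : ℕ, Integrable (fun x => x ^ k) ν) (n : ℕ) :
    ∫ ω : Fin n → ℝ, (∑ i, ω i) ^ 1 ∂(Measure.pi fun _ => ν) = n * ∫ x, x ^ 1 ∂ν := by
  induction n with
  | zero => simp
  | succ n ih =>
    rw [integral_sum_pow_pi_succ hν]
    simp only [Finset.sum_range_succ, Finset.sum_range_zero, Nat.choose, Nat.sub_self,
      Nat.sub_zero, ih]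
    simp
    ring

lemma integral_sum_pow_two_pi (hν : ∀ k : ℕ, Integrable (fun x => x ^ k) ν) (n : ℕ) :
    ∫ ω : Fin n → ℝ, (∑ i, ω i) ^ 2 ∂(Measure.pi fun _ => ν)
      = n * ∫ x, x ^ 2 ∂ν + n * (n - 1) * (∫ x, x ^ 1 ∂ν) ^ 2 := by
  induction n with
  | zero => simp
  | succ n ih =>
    rw [integral_sum_pow_pi_succ hν]
    simp only [Finset.sum_range_succ, Finset.sum_range_zero, Nat.choose, Nat.reduceSub, ih,
      integral_sum_pow_one_pi hν, pow_zero, integral_const, probReal_univ, smul_eq_mul]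
    push_cast
    ring

lemma integral_sum_pow_three_pi (hν : ∀ k : ℕ, Integrable (fun x => x ^ k) ν) (n : ℕ) :
    ∫ ω : Fin n → ℝ, (∑ i, ω i) ^ 3 ∂(Measure.pi fun _ => ν)
      = n * ∫ x, x ^ 3 ∂ν + 3 * n * (n - 1) * (∫ x, x ^ 2 ∂ν) * (∫ x, x ^ 1 ∂ν)
        + n * (n - 1) * (n - 2) * (∫ x, x ^ 1 ∂ν) ^ 3 := by
  induction n with
  | zero => simp
  | succ n ih =>
    rw [integral_sum_pow_pi_succ hν]
    simp only [Finset.sum_range_succ, Finset.sum_range_zero, Nat.choose, Nat.reduceSub, ih,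
      integral_sum_pow_one_pi hν, integral_sum_pow_two_pi hν, pow_zero, integral_const,
      probReal_univ, smul_eq_mul]
    push_cast
    ring

lemma integral_sum_pow_four_pi (hν : ∀ k : ℕ, Integrable (fun x => x ^ k) ν) (n : ℕ) :
    ∫ ω : Fin n → ℝ, (∑ i, ω i) ^ 4 ∂(Measure.pi fun _ => ν)
      = n * ∫ x, x ^ 4 ∂ν + 4 * n * (n - 1) * (∫ x, x ^ 3 ∂ν) * (∫ x, x ^ 1 ∂ν)
        + 3 * n * (n - 1) * (∫ x, x ^ 2 ∂ν) ^ 2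
        + 6 * n * (n - 1) * (n - 2) * (∫ x, x ^ 2 ∂ν) * (∫ x, x ^ 1 ∂ν) ^ 2
        + n * (n - 1) * (n - 2) * (n - 3) * (∫ x, x ^ 1 ∂ν) ^ 4 := by
  induction n with
  | zero => simp
  | succ n ih =>
    rw [integral_sum_pow_pi_succ hν]
    simp only [Finset.sum_range_succ, Finset.sum_range_zero, Nat.choose, Nat.reduceSub, ih,
      integral_sum_pow_one_pi hν, integral_sum_pow_two_pi hν, integral_sum_pow_three_pi hν,
      pow_zero, integral_const, probReal_univ, smul_eq_mul]
    push_cast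
    ring

end Pi

section PN

variable (μX μY σX σY ρ : ℝ)

instance isProbabilityMeasure_PN : IsProbabilityMeasure (PN μX μY σX σY ρ) :=
  Measure.isProbabilityMeasure_map (by fun_prop)

lemma product_pow_eq_mul_add_pow (u v : ℝ) (k : ℕ) :
    ((μX + σX * u) * (μY + σY * (ρ * u + √(1 - ρ ^ 2) * v))) ^ k
      = (μX + σX * u) ^ k * ((μY + σY * ρ * u) + σY * √(1 - ρ ^ 2) * v) ^ k := by
  rw [← mul_pow]
  ring

lemma integrable_const_mul_pow_gaussianReal (c : ℝ) (k : ℕ) :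
    Integrable (fun x : ℝ => (c * x) ^ k) (gaussianReal 0 1) := by
  simp only [mul_pow]
  exact (integrable_pow_gaussianReal k).const_mul _

lemma integrable_pow_PN (k : ℕ) : Integrable (fun z => z ^ k) (PN μX μY σX σY ρ) := by
  rw [PN, integrable_map_measure (by fun_prop) (by fun_prop)]
  simp only [Function.comp_def, product_pow_eq_mul_add_pow]
  exact integrable_mul_add_pow_prod (h := fun u => (μX + σX * u) ^ k)
    (f := fun u => μY + σY * ρ * u) (g := fun v => σY * √(1 - ρ ^ 2) * v)
    (fun j => integrable_affine_pow_mul_affine_pow_gaussianReal _ _ _ _ k j)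
    (integrable_const_mul_pow_gaussianReal _) k

lemma integral_pow_PN (k : ℕ) :
    ∫ z, z ^ k ∂(PN μX μY σX σY ρ)
      = ∑ j ∈ Finset.range (k + 1),
          (∑ p ∈ Finset.range (k + 1), ∑ q ∈ Finset.range (j + 1),
            (σX ^ p * μX ^ (k - p) * k.choose p)
              * ((σY * ρ) ^ q * μY ^ (j - q) * j.choose q)
              * ∫ x, x ^ (p + q) ∂(gaussianReal 0 1))
            * ((σY * √(1 - ρ ^ 2)) ^ (k - j) * (∫ x, x ^ (k - j) ∂(gaussianReal 0 1))
              * k.choose j) := by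
  rw [PN, integral_map (by fun_prop) (by fun_prop)]
  simp only [product_pow_eq_mul_add_pow]
  rw [integral_mul_add_pow_prod (h := fun u => (μX + σX * u) ^ k)
    (f := fun u => μY + σY * ρ * u) (g := fun v => σY * √(1 - ρ ^ 2) * v)
    (fun j => integrable_affine_pow_mul_affine_pow_gaussianReal _ _ _ _ k j)
    (integrable_const_mul_pow_gaussianReal _) k]
  simp only [integral_affine_pow_mul_affine_pow_gaussianReal, mul_pow _ _ (_ - _),
    integral_const_mul]

lemma integral_pow_one_PN :
    ∫ z, z ^ 1 ∂(PN μX μY σX σY ρ) = μX * μY + ρ * σX * σY := by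
  simp only [integral_pow_PN, Finset.sum_range_succ, Finset.sum_range_zero, Nat.choose,
    Nat.reduceAdd, Nat.reduceSub, mul_pow, integral_pow_zero_gaussianReal,
    integral_pow_one_gaussianReal, integral_pow_two_gaussianReal]
  push_cast
  ring

lemma integral_pow_two_PN (hρ : ρ ^ 2 ≤ 1) :
    ∫ z, z ^ 2 ∂(PN μX μY σX σY ρ)
      = μX ^ 2 * μY ^ 2 + (μX ^ 2 * σY ^ 2 + μY ^ 2 * σX ^ 2)
        + 4 * (ρ * σX * σY) * μX * μY + 2 * (ρ * σX * σY) ^ 2 + σX ^ 2 * σY ^ 2 := by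
  have hs : √(1 - ρ ^ 2) ^ 2 = 1 - ρ ^ 2 := Real.sq_sqrt (by linarith)
  simp only [integral_pow_PN, Finset.sum_range_succ, Finset.sum_range_zero, Nat.choose,
    Nat.reduceAdd, Nat.reduceSub, mul_pow, integral_pow_zero_gaussianReal,
    integral_pow_one_gaussianReal, integral_pow_two_gaussianReal,
    integral_pow_three_gaussianReal, integral_pow_four_gaussianReal]
  simp only [hs]
  push_cast
  ring

lemma integral_pow_three_PN (hρ : ρ ^ 2 ≤ 1) :
    ∫ z, z ^ 3 ∂(PN μX μY σX σY ρ)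
      = μX ^ 3 * μY ^ 3 + 3 * μX * μY * (μX ^ 2 * σY ^ 2 + μY ^ 2 * σX ^ 2)
        + 9 * (ρ * σX * σY) * μX ^ 2 * μY ^ 2
        + 9 * (ρ * σX * σY) * (μX ^ 2 * σY ^ 2 + μY ^ 2 * σX ^ 2)
        + 9 * (2 * (ρ * σX * σY) ^ 2 + σX ^ 2 * σY ^ 2) * μX * μY
        + 3 * (ρ * σX * σY) * (2 * (ρ * σX * σY) ^ 2 + 3 * σX ^ 2 * σY ^ 2) := by
  have hs : √(1 - ρ ^ 2) ^ 2 = 1 - ρ ^ 2 := Real.sq_sqrt (by linarith)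
  simp only [integral_pow_PN, Finset.sum_range_succ, Finset.sum_range_zero, Nat.choose,
    Nat.reduceAdd, Nat.reduceSub, mul_pow, integral_pow_zero_gaussianReal,
    integral_pow_one_gaussianReal, integral_pow_two_gaussianReal,
    integral_pow_three_gaussianReal, integral_pow_four_gaussianReal,
    integral_pow_five_gaussianReal, integral_pow_six_gaussianReal]
  simp only [hs]
  push_cast
  ring

lemma integral_pow_four_PN (hρ : ρ ^ 2 ≤ 1) :
    ∫ z, z ^ 4 ∂(PN μX μY σX σY ρ)
      = μX ^ 4 * μY ^ 4 + 16 * (ρ * σX * σY) * μX ^ 3 * μY ^ 3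
        + 6 * μX ^ 2 * μY ^ 2 * (μX ^ 2 * σY ^ 2 + μY ^ 2 * σX ^ 2)
        + 3 * (μX ^ 4 * σY ^ 4 + μY ^ 4 * σX ^ 4)
        + 48 * (ρ * σX * σY) * μX * μY * (μX ^ 2 * σY ^ 2 + μY ^ 2 * σX ^ 2)
        + 36 * (2 * (ρ * σX * σY) ^ 2 + σX ^ 2 * σY ^ 2) * μX ^ 2 * μY ^ 2
        + 18 * (4 * (ρ * σX * σY) ^ 2 + σX ^ 2 * σY ^ 2) * (μX ^ 2 * σY ^ 2 + μY ^ 2 * σX ^ 2)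
        + 48 * (ρ * σX * σY) * (2 * (ρ * σX * σY) ^ 2 + 3 * σX ^ 2 * σY ^ 2) * μX * μY
        + 24 * (ρ * σX * σY) ^ 4 + 72 * (ρ * σX * σY) ^ 2 * σX ^ 2 * σY ^ 2
        + 9 * σX ^ 4 * σY ^ 4 := by
  have hs : √(1 - ρ ^ 2) ^ 2 = 1 - ρ ^ 2 := Real.sq_sqrt (by linarith)
  have hs4 : √(1 - ρ ^ 2) ^ 4 = (1 - ρ ^ 2) ^ 2 := (pow_mul _ 2 2).trans (by rw [hs])
  simp only [integral_pow_PN, Finset.sum_range_succ, Finset.sum_range_zero, Nat.choose,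
    Nat.reduceAdd, Nat.reduceSub, mul_pow, integral_pow_zero_gaussianReal,
    integral_pow_one_gaussianReal, integral_pow_two_gaussianReal,
    integral_pow_three_gaussianReal, integral_pow_four_gaussianReal,
    integral_pow_five_gaussianReal, integral_pow_six_gaussianReal,
    integral_pow_seven_gaussianReal, integral_pow_eight_gaussianReal]
  simp only [hs, hs4]
  push_cast
  ring

end PN

lemma integral_pow_PNbar (n : ℕ) (μX μY σX σY ρ : ℝ) (k : ℕ) :
    ∫ x, x ^ k ∂(PNbar n μX μY σX σY ρ)
      = (∫ ω : Fin n → ℝ, (∑ i, ω i) ^ k ∂(Measure.pi fun _ => PN μX μY σX σY ρ)) / n ^ k := by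
  rw [PNbar, integral_map (by fun_prop) (by fun_prop)]
  simp only [div_pow, integral_div]

/-- The first four raw moments of the mean `Z̄ₙ` of `n` independent
`PN(μX, μY; σX², σY²; ρ)` random variables (with `r_X = μX/σX`, `r_Y = μY/σY`). -/
theorem raw_moments_PNbar
    (μX μY σX σY ρ : ℝ) (hσX : 0 < σX) (hσY : 0 < σY)
    (hρ₁ : -1 < ρ) (hρ₂ : ρ < 1) (n : ℕ) (hn : 1 ≤ n)
    (rX rY : ℝ) (hrX : rX = μX / σX) (hrY : rY = μY / σY) :
    (∫ x, x ∂(PNbar n μX μY σX σY ρ) = μX * μY + ρ * σX * σY) ∧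
    (∫ x, x ^ 2 ∂(PNbar n μX μY σX σY ρ)
      = σX ^ 2 * σY ^ 2 / n
          * (n * rX ^ 2 * rY ^ 2 + rX ^ 2 + rY ^ 2 + 2 * ρ * (n + 1) * rX * rY
              + ρ ^ 2 * (n + 1) + 1)) ∧
    (∫ x, x ^ 3 ∂(PNbar n μX μY σX σY ρ)
      = σX ^ 3 * σY ^ 3 / n ^ 2
          * (n ^ 2 * rX ^ 3 * rY ^ 3 + 3 * n * rX * rY * (rX ^ 2 + rY ^ 2)
              + 3 * ρ * n * (n + 2) * rX ^ 2 * rY ^ 2 + 3 * ρ * (n + 2) * (rX ^ 2 + rY ^ 2)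
              + 3 * (n + 2) * (ρ ^ 2 * (n + 1) + 1) * rX * rY
              + ρ * (n + 2) * (ρ ^ 2 * (n + 1) + 3))) ∧
    (∫ x, x ^ 4 ∂(PNbar n μX μY σX σY ρ)
      = σX ^ 4 * σY ^ 4 / n ^ 3
          * (n ^ 3 * rX ^ 4 * rY ^ 4 + 4 * ρ * n ^ 2 * (n + 3) * rX ^ 3 * rY ^ 3
              + 6 * n ^ 2 * rX ^ 2 * rY ^ 2 * (rX ^ 2 + rY ^ 2) + 3 * n * (rX ^ 4 + rY ^ 4)
              + 12 * ρ * n * (n + 3) * rX * rY * (rX ^ 2 + rY ^ 2)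
              + 6 * n * (ρ ^ 2 * (n + 2) * (n + 3) + (n + 5)) * rX ^ 2 * rY ^ 2
              + 6 * (n + 2) * (ρ ^ 2 * (n + 3) + 1) * (rX ^ 2 + rY ^ 2)
              + 4 * ρ * (n + 2) * (n + 3) * (ρ ^ 2 * (n + 1) + 3) * rX * rY
              + ρ ^ 4 * (n + 1) * (n + 2) * (n + 3) + 6 * ρ ^ 2 * (n + 2) * (n + 3)
              + 3 * (n + 2))) := by
  have hν := integrable_pow_PN μX μY σX σY ρ
  have hρ : ρ ^ 2 ≤ 1 := by nlinarith
  have hn0 : (n : ℝ) ≠ 0 := by positivity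
  have hX : μX = σX * rX := by rw [hrX]; field_simp
  have hY : μY = σY * rY := by rw [hrY]; field_simp
  refine ⟨?_, ?_, ?_, ?_⟩
  · have h := integral_pow_PNbar n μX μY σX σY ρ 1
    rw [integral_sum_pow_one_pi hν, integral_pow_one_PN] at h
    simp only [pow_one] at h
    rw [h]
    field_simp
  · rw [integral_pow_PNbar, integral_sum_pow_two_pi hν, integral_pow_one_PN,
      integral_pow_two_PN _ _ _ _ _ hρ, hX, hY]
    field_simp
    ring
  · rw [integral_pow_PNbar, integral_sum_pow_three_pi hν, integral_pow_one_PN,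
      integral_pow_two_PN _ _ _ _ _ hρ, integral_pow_three_PN _ _ _ _ _ hρ, hX, hY]
    field_simp
    ring
  · rw [integral_pow_PNbar, integral_sum_pow_four_pi hν, integral_pow_one_PN,
      integral_pow_two_PN _ _ _ _ _ hρ, integral_pow_three_PN _ _ _ _ _ hρ,
      integral_pow_four_PN _ _ _ _ _ hρ, hX, hY]
    field_simp
    ring
end
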